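/- (Lemma B.1, stability estimate.) Let p ≥ 1 and α ∈ (0,1), and suppose Assumption B holds. Then there is a constant C ≥ 0 such that for any x₀, x₀′ ∈ Lᵖ([0,T];ℝⁿ) and any u, u′ ∈ 𝒰ᵖ[0,T], the solutions of the generalized Volterra equation satisfy ‖x(·;x₀,u) − x(·;x₀′,u′)‖_{Lᵖ([0,T];ℝⁿ)} ≤ C‖x₀ − x₀′‖_{Lᵖ([0,T];ℝⁿ)} + C[∫₀ᵀ(∫₀ᵗ |f(t,s,x(s;x₀,u),u(s)) − f(t,s,x(s;x₀,u),u′(s))|/(t−s)^{1−α} ds)ᵖ dt]^{1/p} + C[∫₀ᵀ(∫₀ᵗ |g(t,s,x(s;x₀,u),u(s)) − g(t,s,x(s;x₀,u),u′(s))| ds)ᵖ dt]^{1/p}. -/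

import Mathlib

open MeasureTheory Set

noncomputable section

/-- Euclidean space `ℝ^k`. -/
abbrev Euc (k : ℕ) := EuclideanSpace ℝ (Fin k)

/-- Admissible controls in `𝒰ᵖ[0,T]`. -/
def Admissible {d : ℕ} (T p : ℝ) (U : Set (Euc d)) (u₀ : Euc d) (u : ℝ → Euc d) : Prop :=
  Measurable u ∧ (∀ t, u t ∈ U) ∧ IntegrableOn (fun t => ‖u t - u₀‖ ^ p) (Set.Ioc 0 T)

/-- `x` is an `Lᵖ`-solution of the generalized Volterra equation with time-dependent
initial condition `x₀`, control `u`. -/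
def IsLpSolution {n d : ℕ} (T α p : ℝ) (f g : ℝ → ℝ → Euc n → Euc d → Euc n)
    (x₀ : ℝ → Euc n) (u : ℝ → Euc d) (x : ℝ → Euc n) : Prop :=
  AEStronglyMeasurable x (volume.restrict (Set.Ioc 0 T)) ∧
  IntegrableOn (fun t => ‖x t‖ ^ p) (Set.Ioc 0 T) ∧
  ∀ᵐ t ∂(volume.restrict (Set.Ioc 0 T)),
    x t = x₀ t + (∫ s in Set.Ioc 0 t, ((t - s) ^ (α - 1)) • f t s (x s) (u s))
        + ∫ s in Set.Ioc 0 t, g t s (x s) (u s)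

lemma young {p q : ℝ} (hp : 1 ≤ p) (hq : 1 ≤ q) {μ : Measure ℝ} [SFinite μ] (hμ : μ ≤ volume)
   {B : ENNReal} {K : ℝ → ENNReal} (hK : Measurable K)
   (HK : ∀ k e : ℝ → ENNReal, Measurable k → Measurable e → ∫⁻ s, k s * K s * e s ∂μ ≤
     B * (∫⁻ s, k s ^ q * e s ^ p ∂μ) ^ (1/p) * (∫⁻ s, k s ^ q ∂μ) ^ (1/q - 1/p)) (hqp : q ≤ p)
   {k e : ℝ → ENNReal} (hk : Measurable k) (he : Measurable e) :
   (∫⁻ t, (∫⁻ s, k (t - s) * K s * e s ∂μ) ^ p ∂μ) ^ (1/p) ≤ 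
     B * (∫⁻ s, k s ^ q) ^ (1/q) * (∫⁻ s, e s ^ p ∂μ) ^ (1/p) := by
  have hp0 : 0 < p := by linarith
  have hq0 : 0 < q := by linarith
  have hr : 0 ≤ 1/q - 1/p := by
    have := one_div_le_one_div_of_le hq0 hqp
    linarith
  set J := ∫⁻ s, k s ^ q with hJ
  have h1 : ∀ t, (∫⁻ s, k (t - s) * K s * e s ∂μ) ^ p ≤ 
      (B * J ^ (1/q - 1/p)) ^ p * ∫⁻ s, k (t-s) ^ q * e s ^ p ∂μ := by
    intro t
    have h2 := HK (fun s => k (t - s)) e (hk.comp (measurable_const.sub measurable_id)) he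
    have h3 : ∫⁻ s, k (t - s) ^ q ∂μ ≤ J := by
      rw [hJ, ← lintegral_sub_left_eq_self (fun s => k s ^ q) t]
      exact lintegral_mono' hμ le_rfl
    calc _ ≤ (B * J ^ (1/q - 1/p) * (∫⁻ s, k (t-s) ^ q * e s ^ p ∂μ) ^ (1/p)) ^ p := by
            refine ENNReal.rpow_le_rpow (h2.trans ?_) hp0.le
            rw [mul_right_comm]
            gcongr
      _ = _ := by
            rw [ENNReal.mul_rpow_of_nonneg _ _ hp0.le, ← ENNReal.rpow_mul, one_div_mul_cancel hp0.ne', ENNReal.rpow_one]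
  have hm : Measurable (fun z : ℝ × ℝ => k (z.1 - z.2) ^ q * e z.2 ^ p) := by fun_prop
  have h4 : ∫⁻ t, (∫⁻ s, k (t - s) * K s * e s ∂μ) ^ p ∂μ ≤ 
      (B * J ^ (1/q - 1/p)) ^ p * (J * ∫⁻ s, e s ^ p ∂μ) := by
    refine (lintegral_mono h1).trans ?_
    rw [lintegral_const_mul _ hm.lintegral_prod_right']
    gcongr
    rw [lintegral_lintegral_swap hm.aemeasurable, ← lintegral_const_mul _ (by fun_prop)]
    refine lintegral_mono fun s => ?_
    simp only
    rw [lintegral_mul_const _ (by fun_prop)]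
    gcongr
    rw [hJ, ← lintegral_sub_right_eq_self (fun s => k s ^ q) s]
    exact lintegral_mono' hμ le_rfl
  calc _ ≤ ((B * J ^ (1/q - 1/p)) ^ p * (J * ∫⁻ s, e s ^ p ∂μ)) ^ (1/p) := by gcongr
    _ = B * (J ^ (1/q - 1/p) * J ^ (1/p)) * (∫⁻ s, e s ^ p ∂μ) ^ (1/p) := by
      rw [ENNReal.mul_rpow_of_nonneg _ _ (show 0 ≤ 1/p by positivity), ENNReal.mul_rpow_of_nonneg J _ (show 0 ≤ 1/p by positivity), ← ENNReal.rpow_mul, mul_one_div_cancel hp0.ne', ENNReal.rpow_one]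
      ring
    _ = _ := by
      rw [← ENNReal.rpow_add_of_nonneg _ _ hr (by positivity)]
      simp

lemma holder3 {p r q : ℝ} (hp : 1 < p) (hr : p / (p-1) < r) (hq : 1/q = 1 - 1/r)
    {μ : Measure ℝ} {K : ℝ → ENNReal} (hK : Measurable K) (k e : ℝ → ENNReal) (hk : Measurable k) (he : Measurable e) : ∫⁻ s, k s * K s * e s ∂μ ≤
     (∫⁻ s, K s ^ r ∂μ) ^ (1/r) * (∫⁻ s, k s ^ q * e s ^ p ∂μ) ^ (1/p) * (∫⁻ s, k s ^ q ∂μ) ^ (1/q - 1/p) := by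
  have hp0 : 0 < p := by linarith
  have hr0 : 0 < r := lt_trans (div_pos hp0 (by linarith)) hr
  have hw : 0 ≤ 1/q - 1/p := by
    rw [hq]
    have := one_div_le_one_div_of_le (div_pos hp0 (by linarith)) hr.le
    have h2 : 1 / (p/(p-1)) = 1 - 1/p := by field_simp
    linarith
  have hq0 : 0 < q := by
    have : 0 < 1/p := by positivity
    exact one_div_pos.mp (by linarith)
  have := ENNReal.lintegral_prod_norm_pow_le (μ := μ) (Finset.univ : Finset (Fin 3)) (f := ![fun s => K s ^ r, fun s => k s ^ q * e s ^ p, fun s => k s ^ q]) (p := ![1/r, 1/p, 1/q-1/p]) (by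
      intro i _; fin_cases i <;> simp <;> fun_prop) (by simp [Fin.sum_univ_three]; simp at hq; linarith) (by
      intro i _; fin_cases i
      · simp [hr0.le]
      · simp [hp0.le]
      · simpa using hw)
  simp only [Fin.prod_univ_three, Matrix.cons_val_zero, Matrix.cons_val_one, Matrix.cons_val] at this
  refine le_trans (le_of_eq ?_) this
  congr 1; ext s
  rw [ENNReal.mul_rpow_of_nonneg _ _ (by positivity), ← ENNReal.rpow_mul, ← ENNReal.rpow_mul (e s), ← ENNReal.rpow_mul (k s), ← ENNReal.rpow_mul (k s), mul_one_div_cancel hp0.ne', mul_one_div_cancel hr0.ne', ENNReal.rpow_one, ENNReal.rpow_one]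
  have : k s = k s ^ (q * (1/p)) * k s ^ (q * (1/q-1/p)) := by
    rw [← ENNReal.rpow_add_of_nonneg _ _ (by positivity) (by positivity), ← mul_add]
    have : q * (1/p + (1/q - 1/p)) = 1 := by field_simp; ring
    rw [this, ENNReal.rpow_one]
  conv_lhs => rw [this]
  ring

lemma gron {p q T : ℝ} (hp : 1 ≤ p) (hq : 1 ≤ q) (hqp : q ≤ p)
   {B : ENNReal} (hB : B ≠ ⊤) {K : ℝ → ENNReal} (hK : Measurable K)
   (HK : ∀ k e : ℝ → ENNReal, Measurable k → Measurable e → 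
     ∫⁻ s, k s * K s * e s ∂(volume.restrict (Ioc 0 T)) ≤
     B * (∫⁻ s, k s ^ q * e s ^ p ∂(volume.restrict (Ioc 0 T))) ^ (1/p) * (∫⁻ s, k s ^ q ∂(volume.restrict (Ioc 0 T))) ^ (1/q - 1/p)) 
   {w : ℝ → ENNReal} (hw : Measurable w) (hw0 : ∀ t ≤ 0, w t = 0) (hwq : ∫⁻ t, w t ^ q ≠ ⊤) :
   ∃ C : ENNReal, C ≠ ⊤ ∧ ∀ E a : ℝ → ENNReal, Measurable E → AEMeasurable a (volume.restrict (Ioc 0 T)) →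
     ∫⁻ t, E t ^ p ∂(volume.restrict (Ioc 0 T)) ≠ ⊤ →
     (∀ᵐ t ∂(volume.restrict (Ioc 0 T)), E t ≤ a t + ∫⁻ s, w (t - s) * K s * E s ∂(volume.restrict (Ioc 0 T))) →
     (∫⁻ t, E t ^ p ∂(volume.restrict (Ioc 0 T))) ^ (1/p) ≤ C * (∫⁻ t, a t ^ p ∂(volume.restrict (Ioc 0 T))) ^ (1/p) := by
  have hp0 : 0 < p := by linarith
  have hq0 : 0 < q := by linarith
  set μ := volume.restrict (Ioc 0 T) with hμ
  let D : ℝ → ℝ → ENNReal := fun l t => ENNReal.ofReal (Real.exp (-(l * t)))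
  have hDm : ∀ l, Measurable (D l) := fun l => by fun_prop
  have hD1 : ∀ l t, 0 ≤ l → 0 ≤ t → D l t ≤ 1 := by
    intro l t hl ht
    simp only [D, ENNReal.ofReal_le_one, Real.exp_le_one_iff]
    nlinarith [mul_nonneg hl ht]
  have hlim : Filter.Tendsto (fun l : ℝ => ∫⁻ t, (w t * D l t) ^ q) Filter.atTop (nhds (∫⁻ t : ℝ, 0)) := by
    refine tendsto_lintegral_filter_of_dominated_convergence (fun t => w t ^ q) ?_ ?_ hwq ?_
    · exact Filter.Eventually.of_forall fun l => by fun_prop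
    · filter_upwards [Filter.eventually_ge_atTop 0] with l hl
      refine Filter.Eventually.of_forall fun t => ?_
      rcases le_total t 0 with ht | ht
      · simp [hw0 t ht]
      · gcongr
        exact mul_le_of_le_one_right' (hD1 l t hl ht)
    · have hfin : ∀ᵐ t, w t ^ q < ⊤ := ae_lt_top (by fun_prop) hwq
      filter_upwards [hfin] with t ht
      rcases le_or_gt t 0 with h0 | h0
      · simp [hw0 t h0, hq0]
      · have hwt : w t ≠ ⊤ := by
          intro h; simp [h, hq0] at ht
        have h1 : Filter.Tendsto (fun l : ℝ => D l t) Filter.atTop (nhds 0) := by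
          rw [← ENNReal.ofReal_zero]
          refine ENNReal.tendsto_ofReal ?_
          refine Real.tendsto_exp_neg_atTop_nhds_zero.comp ?_
          exact Filter.tendsto_id.atTop_mul_const h0
        have h2 := (ENNReal.Tendsto.const_mul h1 (Or.inr hwt)).ennrpow_const q
        simpa [hq0] using h2
  have hlim2 : Filter.Tendsto (fun l : ℝ => B * (∫⁻ t, (w t * D l t) ^ q) ^ (1/q)) Filter.atTop (nhds 0) := by
    have := ENNReal.Tendsto.const_mul (hlim.ennrpow_const (1/q)) (Or.inr hB)
    simpa [hq0] using this
  obtain ⟨l, hl2, hl0⟩ := ((hlim2.eventually (ge_mem_nhds (show (0:ENNReal) < 2⁻¹ by simp))).and (Filter.eventually_ge_atTop 0)).exists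
  refine ⟨ENNReal.ofReal (Real.exp (l * T)) * 2, by finiteness, ?_⟩
  intro E a hE ha hfin hle
  have hy := young hp hq (μ := μ) Measure.restrict_le_self hK HK hqp (k := fun t => w t * D l t) (e := fun t => E t * D l t) (by fun_prop) (by fun_prop)
  set X := (∫⁻ t, (E t * D l t) ^ p ∂μ) ^ (1/p) with hX
  set A := (∫⁻ t, a t ^ p ∂μ) ^ (1/p) with hA
  have hpos : ∀ᵐ t ∂μ, t ∈ Ioc 0 T := ae_restrict_mem measurableSet_Ioc
  have hXfin : X ≠ ⊤ := by
    refine ENNReal.rpow_ne_top_of_nonneg (by positivity) (ne_top_of_le_ne_top hfin ?_)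
    refine lintegral_mono_ae ?_
    filter_upwards [hpos] with t ht
    gcongr
    exact mul_le_of_le_one_right' (hD1 l t hl0 ht.1.le)
  have hXA : X ≤ A + 2⁻¹ * X := by
    calc X ≤ (∫⁻ t, (((fun t => a t * D l t) + fun t => ∫⁻ s, (w (t - s) * D l (t-s)) * K s * (E s * D l s) ∂μ) t) ^ p ∂μ) ^ (1/p) := by
          rw [hX]
          gcongr 1
          refine lintegral_mono_ae ?_
          filter_upwards [hle] with t ht
          gcongr
          simp only [Pi.add_apply]
          calc E t * D l t ≤ (a t + ∫⁻ s, w (t - s) * K s * E s ∂μ) * D l t := by gcongr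
            _ = _ := by
              rw [add_mul, ← lintegral_mul_const _ (by fun_prop)]
              congr 2
              ext s
              have : D l t = D l (t-s) * D l s := by
                simp only [D]
                rw [← ENNReal.ofReal_mul (by positivity), ← Real.exp_add]
                congr 2; ring
              rw [this]; ring
      _ ≤ (∫⁻ t, (a t * D l t) ^ p ∂μ) ^ (1/p) + (∫⁻ t, (∫⁻ s, (w (t - s) * D l (t-s)) * K s * (E s * D l s) ∂μ) ^ p ∂μ) ^ (1/p) := by
          refine ENNReal.lintegral_Lp_add_le (by fun_prop) ?_ hp
          have hm : Measurable (fun z : ℝ × ℝ => (w (z.1 - z.2) * D l (z.1-z.2)) * K z.2 * (E z.2 * D l z.2)) := by fun_prop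
          exact hm.lintegral_prod_right'.aemeasurable
      _ ≤ A + 2⁻¹ * X := by
          gcongr 1
          · rw [hA]
            gcongr 1
            refine lintegral_mono_ae ?_
            filter_upwards [hpos] with t ht
            gcongr
            exact mul_le_of_le_one_right' (hD1 l t hl0 ht.1.le)
          · refine hy.trans ?_
            gcongr
  have hX2 : X ≤ 2 * A := by
    have h1 : X = 2⁻¹ * X + 2⁻¹ * X := by
      rw [← add_mul, ENNReal.inv_two_add_inv_two, one_mul]
    rw [h1] at hXA
    have hf2 : 2⁻¹ * X ≠ ⊤ := by finiteness
    have h3 : 2⁻¹ * X ≤ A := by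
      rw [← h1] at hXA
      nth_rewrite 1 [h1] at hXA
      exact (ENNReal.add_le_add_iff_right hf2).mp hXA
    calc X = 2 * (2⁻¹ * X) := by rw [← mul_assoc, ENNReal.mul_inv_cancel (by simp) (by simp), one_mul]
      _ ≤ _ := by gcongr
  calc (∫⁻ t, E t ^ p ∂μ) ^ (1/p) ≤ (∫⁻ t, ENNReal.ofReal (Real.exp (l * T)) ^ p * (E t * D l t) ^ p ∂μ) ^ (1/p) := by
        gcongr 1
        refine lintegral_mono_ae ?_
        filter_upwards [hpos] with t ht
        rw [← ENNReal.mul_rpow_of_nonneg _ _ hp0.le]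
        gcongr
        calc E t = E t * 1 := by simp
          _ ≤ E t * (ENNReal.ofReal (Real.exp (l * T)) * D l t) := by
            gcongr
            simp only [D]
            rw [← ENNReal.ofReal_mul (by positivity), ← Real.exp_add]
            simp
            nlinarith [mul_le_mul_of_nonneg_left ht.2 hl0]
          _ = _ := by ring
    _ = ENNReal.ofReal (Real.exp (l * T)) * X := by
        rw [lintegral_const_mul _ (by fun_prop), ENNReal.mul_rpow_of_nonneg _ _ (by positivity), ← ENNReal.rpow_mul, mul_one_div_cancel hp0.ne', ENNReal.rpow_one]
    _ ≤ _ := by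
        rw [mul_assoc]; gcongr

lemma conv_real {p : ℝ} (hp : 1 ≤ p) {n : ℕ} {μ : Measure ℝ} {h : ℝ → Euc n}
    (hi : Integrable (fun t => ‖h t‖ ^ p) μ) :
    ENNReal.ofReal ((∫ t, ‖h t‖ ^ p ∂μ) ^ (1/p)) = (∫⁻ t, ‖h t‖ₑ ^ p ∂μ) ^ (1/p) := by
  have hp0 : 0 < p := by linarith
  rw [← ENNReal.ofReal_rpow_of_nonneg (by positivity) (by positivity),
    ofReal_integral_eq_lintegral_ofReal hi (Filter.Eventually.of_forall fun t => by positivity)]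
  congr 2
  ext t
  rw [← ENNReal.ofReal_rpow_of_nonneg (by positivity) hp0.le, ofReal_norm]

lemma integrable_sub_rpow {p : ℝ} (hp : 1 ≤ p) {n : ℕ} {μ : Measure ℝ} {h h' : ℝ → Euc n}
    (hm : AEStronglyMeasurable h μ) (hm' : AEStronglyMeasurable h' μ)
    (hi : Integrable (fun t => ‖h t‖ ^ p) μ) (hi' : Integrable (fun t => ‖h' t‖ ^ p) μ) :
    Integrable (fun t => ‖h t - h' t‖ ^ p) μ := by
  have hp0 : 0 < p := by linarith
  have e : (ENNReal.ofReal p).toReal = p := ENNReal.toReal_ofReal hp0.le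
  have h0 : ENNReal.ofReal p ≠ 0 := by simpa using hp0
  have key : ∀ k : ℝ → Euc n, AEStronglyMeasurable k μ →
      (Integrable (fun t => ‖k t‖ ^ p) μ ↔ MemLp k (ENNReal.ofReal p) μ) := by
    intro k hk
    have := integrable_norm_rpow_iff hk h0 ENNReal.ofReal_ne_top
    rwa [e] at this
  exact (key _ (hm.sub hm')).2 (((key _ hm).1 hi).sub ((key _ hm').1 hi'))

lemma fin_of_integrable {p : ℝ} (hp : 1 ≤ p) {n : ℕ} {μ : Measure ℝ} {h : ℝ → Euc n}
    (hi : Integrable (fun t => ‖h t‖ ^ p) μ) : ∫⁻ t, ‖h t‖ₑ ^ p ∂μ ≠ ⊤ := by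
  have hp0 : 0 < p := by linarith
  have := conv_real hp hi
  intro h
  rw [h, ENNReal.top_rpow_of_pos (by positivity)] at this
  exact ENNReal.ofReal_ne_top this

lemma enorm_sub_integral_le {n : ℕ} {ν : Measure ℝ} {F F' : ℝ → Euc n}
    (hF : AEStronglyMeasurable F ν) (hF' : AEStronglyMeasurable F' ν) :
    ‖(∫ s, F s ∂ν) - ∫ s, F' s ∂ν‖ₑ ≤ ∫⁻ s, ‖F s - F' s‖ₑ ∂ν := by
  by_cases htop : ∫⁻ s, ‖F s - F' s‖ₑ ∂ν = ⊤
  · rw [htop]; exact le_top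
  have hi : Integrable (F - F') ν := ⟨hF.sub hF', lt_top_iff_ne_top.2 htop⟩
  by_cases h1 : Integrable F ν
  · have h2 : Integrable F' ν := by simpa using h1.sub hi
    rw [← integral_sub h1 h2]
    exact enorm_integral_le_lintegral_enorm _
  · have h2 : ¬ Integrable F' ν := fun h => h1 (by simpa using h.add hi)
    rw [integral_undef h1, integral_undef h2]
    simp

lemma inner_measurable {G : ℝ → ℝ → ℝ} (hG : Measurable fun z : ℝ × ℝ => G z.1 z.2) :
    Measurable fun t => ∫⁻ s in Ioc 0 t, ENNReal.ofReal (G t s) := by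
  have hS : MeasurableSet {z : ℝ × ℝ | z.2 ∈ Ioc 0 z.1} :=
    (measurableSet_lt measurable_const measurable_snd).inter
      (measurableSet_le measurable_snd measurable_fst)
  have hm : Measurable ({z : ℝ × ℝ | z.2 ∈ Ioc 0 z.1}.indicator
    (fun z => ENNReal.ofReal (G z.1 z.2))) := (by fun_prop : Measurable _).indicator hS
  have := hm.lintegral_prod_right' (ν := volume)
  convert this using 2 with t
  rw [← lintegral_indicator measurableSet_Ioc]
  rfl

lemma conv_inner {p T : ℝ} (hp : 1 ≤ p) {G : ℝ → ℝ → ℝ}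
    (hG : Measurable fun z : ℝ × ℝ => G z.1 z.2) (hG0 : ∀ t s, s ∈ Ioc 0 t → 0 ≤ G t s)
    (hfin : ∫⁻ t in Ioc 0 T, (∫⁻ s in Ioc 0 t, ENNReal.ofReal (G t s)) ^ p ≠ ⊤) :
    ENNReal.ofReal ((∫ t in Ioc 0 T, (∫ s in Ioc 0 t, G t s) ^ p) ^ (1/p)) =
      (∫⁻ t in Ioc 0 T, (∫⁻ s in Ioc 0 t, ENNReal.ofReal (G t s)) ^ p) ^ (1/p) := by
  have hp0 : 0 < p := by linarith
  have hA := inner_measurable hG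
  have h1 : ∀ t, (∫ s in Ioc 0 t, G t s) ^ p =
      ((∫⁻ s in Ioc 0 t, ENNReal.ofReal (G t s)) ^ p).toReal := by
    intro t
    rw [integral_eq_lintegral_of_nonneg_ae, ENNReal.toReal_rpow]
    · filter_upwards [ae_restrict_mem measurableSet_Ioc] with s hs
      exact hG0 t s hs
    · exact (hG.comp measurable_prodMk_left).aestronglyMeasurable
  simp_rw [h1]
  rw [integral_toReal (hA.pow_const p).aemeasurable (ae_lt_top (hA.pow_const p) hfin), ENNReal.toReal_rpow,
    ENNReal.ofReal_toReal (ENNReal.rpow_ne_top_of_nonneg (by positivity) hfin)]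

/-- the dominating kernel -/
def ker (T α : ℝ) : ℝ → ENNReal :=
  (Ioc 0 T).indicator fun τ => ENNReal.ofReal ((1 + T ^ (1 - α)) * τ ^ (α - 1))

lemma ker_measurable (T α : ℝ) : Measurable (ker T α) :=
  (by fun_prop : Measurable _).indicator measurableSet_Ioc

lemma ker_fin {T α q : ℝ} (hT : 0 < T) (hq : 1 ≤ q) (hqα : -1 < (α - 1) * q) :
    ∫⁻ t, ker T α t ^ q ≠ ⊤ := by
  have hq0 : 0 < q := by linarith
  have h1 : ∀ t, ker T α t ^ q = (Ioc 0 T).indicator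
      (fun τ => ENNReal.ofReal ((1 + T ^ (1 - α)) ^ q * τ ^ ((α - 1) * q))) t := by
    intro t
    unfold ker
    by_cases ht : t ∈ Ioc 0 T
    · simp only [indicator_of_mem ht]
      have h0 := ht.1
      rw [ENNReal.ofReal_rpow_of_nonneg (by positivity) hq0.le,
        Real.mul_rpow (by positivity) (by positivity), Real.rpow_mul h0.le]
    · simp [indicator_of_notMem ht, hq0]
  simp_rw [h1]
  rw [lintegral_indicator measurableSet_Ioc]
  have := (intervalIntegral.intervalIntegrable_rpow' (a := 0) (b := T) hqα).1.const_mul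
    ((1 + T ^ (1 - α)) ^ q)
  exact this.lintegral_lt_top.ne

lemma ker_bounds {T α τ : ℝ} (hT : 0 < T) (hα : α < 1) (h0 : 0 < τ) (h1 : τ ≤ T) :
    τ ^ (α - 1) ≤ (1 + T ^ (1 - α)) * τ ^ (α - 1) ∧ 1 ≤ (1 + T ^ (1 - α)) * τ ^ (α - 1) := by
  have a : 0 < τ ^ (α - 1) := by positivity
  have b : 0 < T ^ (1 - α) := by positivity
  have c : T ^ (α - 1) ≤ τ ^ (α - 1) := Real.rpow_le_rpow_of_nonpos h0 h1 (by linarith)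
  have e : T ^ (1 - α) * T ^ (α - 1) = 1 := by
    rw [← Real.rpow_add hT]; simp
  constructor <;> nlinarith [mul_le_mul_of_nonneg_left c b.le]

lemma exists_exponent {T α p : ℝ} (hα : α ∈ Set.Ioo (0:ℝ) 1)
    (hp1 : 1 ≤ p) (K : ℝ → ℝ) (hK_nonneg : ∀ s, 0 ≤ K s) (hK_meas : Measurable K)
    (hK_L : (1 < p ∧ ∃ r₁ : ℝ, max (1 / α) (p / (p - 1)) < r₁ ∧
              IntegrableOn (fun s => K s ^ r₁) (Set.Ioc 0 T)) ∨
            (p = 1 ∧ ∃ M : ℝ, ∀ s ∈ Set.Ioc (0:ℝ) T, K s ≤ M)) :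
    ∃ (q : ℝ) (B : ENNReal), 1 ≤ q ∧ q ≤ p ∧ -1 < (α - 1) * q ∧ B ≠ ⊤ ∧
      ∀ k e : ℝ → ENNReal, Measurable k → Measurable e →
     ∫⁻ s, k s * ENNReal.ofReal (K s) * e s ∂(volume.restrict (Ioc 0 T)) ≤
     B * (∫⁻ s, k s ^ q * e s ^ p ∂(volume.restrict (Ioc 0 T))) ^ (1/p) *
      (∫⁻ s, k s ^ q ∂(volume.restrict (Ioc 0 T))) ^ (1/q - 1/p) := by
  obtain ⟨hα0, hα1⟩ := hα
  rcases hK_L with ⟨hp, r, hr, hi⟩ | ⟨rfl, M, hM⟩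
  · obtain ⟨hr1, hr2⟩ := max_lt_iff.1 hr
    have hp0 : 0 < p := by linarith
    have hr1' : 1 < r := by
      refine lt_of_le_of_lt ?_ hr1
      rw [le_div_iff₀ hα0]; linarith
    have hr0 : 0 < r := by linarith
    have hr3 : 0 < r - 1 := by linarith
    refine ⟨r / (r - 1), (∫⁻ s, ENNReal.ofReal (K s) ^ r ∂(volume.restrict (Ioc 0 T))) ^ (1/r),
      ?_, ?_, ?_, ?_, ?_⟩
    · rw [le_div_iff₀ hr3]; linarith
    · rw [div_lt_iff₀ (by linarith)] at hr2
      rw [div_le_iff₀ hr3]; nlinarith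
    · rw [div_lt_iff₀ hα0] at hr1
      rw [← mul_div_assoc, lt_div_iff₀ hr3]; nlinarith
    · refine ENNReal.rpow_ne_top_of_nonneg (by positivity) ?_
      have := hi.lintegral_lt_top.ne
      simpa only [ENNReal.ofReal_rpow_of_nonneg (hK_nonneg _) hr0.le] using this
    · intro k e hk he
      exact holder3 hp hr2 (by field_simp) (by fun_prop) k e hk he
  · refine ⟨1, ENNReal.ofReal M, le_rfl, le_rfl, by linarith, by simp, ?_⟩
    intro k e hk he
    simp only [ENNReal.rpow_one, div_one, sub_self, ENNReal.rpow_zero, mul_one]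
    rw [← lintegral_const_mul _ (by fun_prop)]
    refine lintegral_mono_ae ?_
    filter_upwards [ae_restrict_mem measurableSet_Ioc] with s hs
    calc k s * ENNReal.ofReal (K s) * e s ≤ k s * ENNReal.ofReal M * e s := by
          gcongr; exact hM s hs
      _ = _ := by ring

/-- from a bound on the open interval to the convolution over `Ioc 0 T` -/
lemma inner_le {T t : ℝ} (ht : t ≤ T) {h H : ℝ → ENNReal} (hle : ∀ s, 0 < s → s < t → h s ≤ H s) :
    ∫⁻ s in Ioc 0 t, h s ≤ ∫⁻ s in Ioc 0 t, H s := by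
  rw [← restrict_Ioo_eq_restrict_Ioc]
  refine setLIntegral_mono_ae' measurableSet_Ioo (Filter.Eventually.of_forall fun s hs => ?_)
  exact hle s hs.1 hs.2

lemma inner_le' {T t : ℝ} (ht : t ≤ T) {h H : ℝ → ENNReal} (hle : ∀ s, 0 < s → s < t → h s ≤ H s) :
    ∫⁻ s in Ioc 0 t, h s ≤ ∫⁻ s in Ioc 0 T, H s :=
  (inner_le ht hle).trans (lintegral_mono_set (Ioc_subset_Ioc_right ht))

theorem stability_meas
    {n d : ℕ} (T : ℝ) (hT : 0 < T) (α : ℝ) (hα : α ∈ Set.Ioo (0:ℝ) 1)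
    (p : ℝ) (hp1 : 1 ≤ p)
    (U : Set (Euc d)) (u₀ : Euc d) (hu₀U : u₀ ∈ U)
    (f g : ℝ → ℝ → Euc n → Euc d → Euc n)
    (hf_meas : Measurable fun q : ℝ × ℝ × Euc n × Euc d => f q.1 q.2.1 q.2.2.1 q.2.2.2)
    (hg_meas : Measurable fun q : ℝ × ℝ × Euc n × Euc d => g q.1 q.2.1 q.2.2.1 q.2.2.2)
    -- Assumption B
    (K₀ K : ℝ → ℝ) (hK₀_nonneg : ∀ s, 0 ≤ K₀ s) (hK_nonneg : ∀ s, 0 ≤ K s)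
    (hK₀_meas : Measurable K₀) (hK_meas : Measurable K)
    (r₀ : ℝ) (hr₀ : max (p / (1 + α * p)) 1 < r₀)
    (hK₀_L : IntegrableOn (fun s => K₀ s ^ r₀) (Set.Ioc 0 T))
    (hK_L : (1 < p ∧ ∃ r₁ : ℝ, max (1 / α) (p / (p - 1)) < r₁ ∧
              IntegrableOn (fun s => K s ^ r₁) (Set.Ioc 0 T)) ∨
            (p = 1 ∧ ∃ M : ℝ, ∀ s ∈ Set.Ioc (0:ℝ) T, K s ≤ M))
    (hA_lip : ∀ t s : ℝ, 0 ≤ s → s ≤ t → t ≤ T →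
      ∀ (x x' : Euc n) (u u' : Euc d), u ∈ U → u' ∈ U →
        ‖f t s x u - f t s x' u'‖ + ‖g t s x u - g t s x' u'‖ ≤ K s * (‖x - x'‖ + ‖u - u'‖))
    (hA_zero : ∀ t s : ℝ, 0 ≤ s → s ≤ t → t ≤ T → ∀ u : Euc d, u ∈ U →
      ‖f t s 0 u‖ + ‖g t s 0 u‖ ≤ K₀ s) :
    ∃ C : ℝ, 0 ≤ C ∧
      ∀ x₀ x₀' : ℝ → Euc n,
        AEStronglyMeasurable x₀ (volume.restrict (Set.Ioc 0 T)) →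
        IntegrableOn (fun t => ‖x₀ t‖ ^ p) (Set.Ioc 0 T) →
        AEStronglyMeasurable x₀' (volume.restrict (Set.Ioc 0 T)) →
        IntegrableOn (fun t => ‖x₀' t‖ ^ p) (Set.Ioc 0 T) →
        ∀ u u' : ℝ → Euc d, Admissible T p U u₀ u → Admissible T p U u₀ u' →
        ∀ x x' : ℝ → Euc n, Measurable x → Measurable x' →
          IsLpSolution T α p f g x₀ u x → IsLpSolution T α p f g x₀' u' x' →
          (∫ t in Set.Ioc 0 T, ‖x t - x' t‖ ^ p) ^ (1 / p)
            ≤ C * (∫ t in Set.Ioc 0 T, ‖x₀ t - x₀' t‖ ^ p) ^ (1 / p)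
              + C * (∫ t in Set.Ioc 0 T,
                  (∫ s in Set.Ioc 0 t,
                    ((t - s) ^ (α - 1)) * ‖f t s (x s) (u s) - f t s (x s) (u' s)‖) ^ p) ^ (1 / p)
              + C * (∫ t in Set.Ioc 0 T,
                  (∫ s in Set.Ioc 0 t,
                    ‖g t s (x s) (u s) - g t s (x s) (u' s)‖) ^ p) ^ (1 / p) := by
  obtain ⟨q, B, hq, hqp, hqα, hB, HK⟩ := exists_exponent hα hp1 K hK_nonneg hK_meas hK_L
  have hp0 : 0 < p := by linarith
  have hα1 := hα.2
  have hwm := ker_measurable T α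
  have hwf := ker_fin hT hq hqα
  obtain ⟨C, hC, hgron⟩ := gron hp1 hq hqp hB (by fun_prop) HK hwm
    (fun t ht => indicator_of_notMem (fun h => absurd h.1 (not_lt.2 ht)) _) hwf
  refine ⟨C.toReal, ENNReal.toReal_nonneg, ?_⟩
  intro x₀ x₀' hx₀m hx₀i hx₀m' hx₀i' u u' hu hu' x x' hxm hxm' hx hx'
  obtain ⟨hum, huU, hui⟩ := hu
  obtain ⟨hum', huU', hui'⟩ := hu'
  obtain ⟨-, hxi, hxe⟩ := hx
  obtain ⟨-, hxi', hxe'⟩ := hx'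
  set μ := volume.restrict (Ioc 0 T) with hμ
  -- the two inner integrands
  let Gf : ℝ → ℝ → ℝ := fun t s => (t - s) ^ (α - 1) * ‖f t s (x s) (u s) - f t s (x s) (u' s)‖
  let Gg : ℝ → ℝ → ℝ := fun t s => ‖g t s (x s) (u s) - g t s (x s) (u' s)‖
  have meas : ∀ h : ℝ → ℝ → Euc n → Euc d → Euc n,
      Measurable (fun q : ℝ × ℝ × Euc n × Euc d => h q.1 q.2.1 q.2.2.1 q.2.2.2) →
      ∀ (y : ℝ → Euc n) (v : ℝ → Euc d), Measurable y → Measurable v →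
      Measurable fun z : ℝ × ℝ => h z.1 z.2 (y z.2) (v z.2) := by
    intro h hh y v hy hv
    exact hh.comp (measurable_fst.prodMk (measurable_snd.prodMk
      ((hy.comp measurable_snd).prodMk (hv.comp measurable_snd))))
  have hGf : Measurable fun z : ℝ × ℝ => Gf z.1 z.2 :=
    ((measurable_fst.sub measurable_snd).pow_const _).mul
      ((meas f hf_meas x u hxm hum).sub (meas f hf_meas x u' hxm hum')).norm
  have hGg : Measurable fun z : ℝ × ℝ => Gg z.1 z.2 :=
    ((meas g hg_meas x u hxm hum).sub (meas g hg_meas x u' hxm hum')).norm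
  have hGf0 : ∀ t s, s ∈ Ioc 0 t → 0 ≤ Gf t s := by
    intro t s hs
    have : 0 ≤ t - s := by linarith [hs.2]
    positivity
  have hGg0 : ∀ t s, s ∈ Ioc 0 t → 0 ≤ Gg t s := fun t s hs => norm_nonneg _
  have kb : ∀ t s, t ≤ T → 0 < s → s < t → ∀ (a b c : ℝ), 0 ≤ a → 0 ≤ b → 0 ≤ c → a + b ≤ K s * c →
      ENNReal.ofReal ((t - s) ^ (α - 1) * a + b) ≤
        ker T α (t - s) * ENNReal.ofReal (K s) * ENNReal.ofReal c := by
    intro t s ht hs hst a b c ha hb hc hab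
    have hmem : t - s ∈ Ioc 0 T := ⟨by linarith, by linarith⟩
    have hpos : 0 < t - s := hmem.1
    obtain ⟨h1, h2⟩ := ker_bounds hT hα1 hmem.1 hmem.2
    unfold ker
    rw [indicator_of_mem hmem, ← ENNReal.ofReal_mul (by positivity),
      ← ENNReal.ofReal_mul (mul_nonneg (by positivity) (hK_nonneg s))]
    refine ENNReal.ofReal_le_ofReal ?_
    set k := (1 + T ^ (1 - α)) * (t - s) ^ (α - 1)
    calc (t - s) ^ (α - 1) * a + b ≤ k * a + k * b := by nlinarith
      _ = k * (a + b) := by ring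
      _ ≤ k * (K s * c) := by
        refine mul_le_mul_of_nonneg_left hab (by linarith)
      _ = _ := by ring
  -- finiteness of the forcing terms
  have hdu : Integrable (fun t => ‖u t - u' t‖ ^ p) μ := by
    have := integrable_sub_rpow hp1 (h := fun t => u t - u₀) (h' := fun t => u' t - u₀)
      (hum.sub_const _).aestronglyMeasurable (hum'.sub_const _).aestronglyMeasurable hui hui'
    simpa using this
  have hyoung : ∫⁻ t, (∫⁻ s, ker T α (t - s) * ENNReal.ofReal (K s) * ‖u s - u' s‖ₑ ∂μ) ^ p ∂μ
      ≠ ⊤ := by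
    have := young hp1 hq (μ := μ) Measure.restrict_le_self (by fun_prop) HK hqp hwm
      (e := fun s => ‖u s - u' s‖ₑ) (by fun_prop)
    intro htop
    rw [htop, ENNReal.top_rpow_of_pos (by positivity)] at this
    have h2 := fin_of_integrable hp1 hdu
    refine absurd this (not_le.2 (lt_top_iff_ne_top.2 ?_))
    refine ENNReal.mul_ne_top (ENNReal.mul_ne_top hB ?_) ?_
    · exact ENNReal.rpow_ne_top_of_nonneg (by positivity) hwf
    · exact ENNReal.rpow_ne_top_of_nonneg (by positivity) h2
  have hlipu : ∀ t s, t ≤ T → 0 < s → s < t →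
      ENNReal.ofReal (Gf t s + Gg t s) ≤
        ker T α (t - s) * ENNReal.ofReal (K s) * ‖u s - u' s‖ₑ := by
    intro t s ht hs hst
    rw [← ofReal_norm]
    refine kb t s ht hs hst _ _ _ (norm_nonneg _) (norm_nonneg _) (norm_nonneg _) ?_
    have := hA_lip t s hs.le hst.le ht (x s) (x s) (u s) (u' s) (huU s) (huU' s)
    simpa using this
  have hfinf : ∫⁻ t in Ioc 0 T, (∫⁻ s in Ioc 0 t, ENNReal.ofReal (Gf t s)) ^ p ≠ ⊤ := by
    refine ne_top_of_le_ne_top hyoung (lintegral_mono_ae ?_)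
    filter_upwards [ae_restrict_mem measurableSet_Ioc] with t ht
    refine ENNReal.rpow_le_rpow ?_ hp0.le
    refine inner_le' ht.2 fun s hs hst => le_trans ?_ (hlipu t s ht.2 hs hst)
    exact ENNReal.ofReal_le_ofReal (by linarith [hGg0 t s ⟨hs, hst.le⟩])
  have hfing : ∫⁻ t in Ioc 0 T, (∫⁻ s in Ioc 0 t, ENNReal.ofReal (Gg t s)) ^ p ≠ ⊤ := by
    refine ne_top_of_le_ne_top hyoung (lintegral_mono_ae ?_)
    filter_upwards [ae_restrict_mem measurableSet_Ioc] with t ht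
    refine ENNReal.rpow_le_rpow ?_ hp0.le
    refine inner_le' ht.2 fun s hs hst => le_trans ?_ (hlipu t s ht.2 hs hst)
    exact ENNReal.ofReal_le_ofReal (by linarith [hGf0 t s ⟨hs, hst.le⟩])
  have hAf := inner_measurable hGf
  have hAg := inner_measurable hGg
  have hcf := conv_inner hp1 hGf hGf0 hfinf
  have hcg := conv_inner hp1 hGg hGg0 hfing
  have hdx := integrable_sub_rpow hp1 hxm.aestronglyMeasurable hxm'.aestronglyMeasurable hxi hxi'
  have hdx0 := integrable_sub_rpow hp1 hx₀m hx₀m' hx₀i hx₀i'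
  have hx0ae : AEMeasurable (fun t => ‖x₀ t - x₀' t‖ₑ) μ := (hx₀m.sub hx₀m').enorm
  -- the pointwise inequality
  have hmain := hgron (fun t => ‖x t - x' t‖ₑ)
    ((fun t => ‖x₀ t - x₀' t‖ₑ) + ((fun t => ∫⁻ s in Ioc 0 t, ENNReal.ofReal (Gf t s)) +
      (fun t => ∫⁻ s in Ioc 0 t, ENNReal.ofReal (Gg t s)))) (by fun_prop)
    (hx0ae.add (hAf.aemeasurable.add hAg.aemeasurable)) (fin_of_integrable hp1 hdx) (by
      filter_upwards [ae_restrict_mem measurableSet_Ioc, hxe, hxe'] with t ht h1 h2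
      have mf : ∀ (y : ℝ → Euc n) (v : ℝ → Euc d), Measurable y → Measurable v →
          Measurable (fun s => ((t - s) ^ (α - 1)) • f t s (y s) (v s)) := by
        intro y v hy hv
        exact ((measurable_const.sub measurable_id).pow_const _).smul
          ((meas f hf_meas y v hy hv).comp measurable_prodMk_left)
      have mg : ∀ (y : ℝ → Euc n) (v : ℝ → Euc d), Measurable y → Measurable v →
          Measurable (fun s => g t s (y s) (v s)) := by
        intro y v hy hv
        exact (meas g hg_meas y v hy hv).comp measurable_prodMk_left
      have i1 := enorm_sub_integral_le (ν := volume.restrict (Ioc 0 t))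
        (mf x u hxm hum).aestronglyMeasurable (mf x' u' hxm' hum').aestronglyMeasurable
      have i2 := enorm_sub_integral_le (ν := volume.restrict (Ioc 0 t))
        (mg x u hxm hum).aestronglyMeasurable (mg x' u' hxm' hum').aestronglyMeasurable
      have i3 : (∫⁻ s in Ioc 0 t, ‖(t - s) ^ (α - 1) • f t s (x s) (u s) -
            (t - s) ^ (α - 1) • f t s (x' s) (u' s)‖ₑ) +
          (∫⁻ s in Ioc 0 t, ‖g t s (x s) (u s) - g t s (x' s) (u' s)‖ₑ) ≤
          (∫⁻ s in Ioc 0 t, ENNReal.ofReal (Gf t s)) + (∫⁻ s in Ioc 0 t, ENNReal.ofReal (Gg t s))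
          + ∫⁻ s, ker T α (t - s) * ENNReal.ofReal (K s) * ‖x s - x' s‖ₑ ∂μ := by
        have m1 : Measurable fun s => ENNReal.ofReal (Gf t s) :=
          (hGf.comp measurable_prodMk_left).ennreal_ofReal
        have m2 : Measurable fun s => ENNReal.ofReal (Gg t s) :=
          (hGg.comp measurable_prodMk_left).ennreal_ofReal
        have m0 : Measurable fun s => ‖(t - s) ^ (α - 1) • f t s (x s) (u s) -
            (t - s) ^ (α - 1) • f t s (x' s) (u' s)‖ₑ :=
          ((mf x u hxm hum).sub (mf x' u' hxm' hum')).enorm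
        rw [← lintegral_add_left m0,
          ← lintegral_add_left m1]
        refine le_trans ?_ (add_le_add_right (lintegral_mono_set (Ioc_subset_Ioc_right ht.2)) _)
        have m3 : Measurable fun s => ENNReal.ofReal (Gf t s) + ENNReal.ofReal (Gg t s) := m1.add m2
        rw [← lintegral_add_left m3]
        refine inner_le ht.2 fun s hs hst => ?_
        have hτ : 0 ≤ (t - s) ^ (α - 1) := Real.rpow_nonneg (by linarith) _
        have hl := hA_lip t s hs.le hst.le ht.2 (x s) (x' s) (u' s) (u' s) (huU' s) (huU' s)
        simp only [sub_self, norm_zero, add_zero] at hl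
        have hk := kb t s ht.2 hs hst _ _ _ (norm_nonneg _) (norm_nonneg _) (norm_nonneg _) hl
        rw [ofReal_norm] at hk
        refine le_trans ?_ (add_le_add_right hk _)
        have g1 := hGf0 t s ⟨hs, hst.le⟩
        have g2 := hGg0 t s ⟨hs, hst.le⟩
        rw [← ofReal_norm, ← ofReal_norm,
          ← ENNReal.ofReal_add (norm_nonneg _) (norm_nonneg _), ← ENNReal.ofReal_add g1 g2,
          ← ENNReal.ofReal_add (by positivity) (by positivity)]
        refine ENNReal.ofReal_le_ofReal ?_
        rw [← smul_sub, norm_smul, Real.norm_of_nonneg hτ]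
        have t1 := norm_sub_le_norm_sub_add_norm_sub (f t s (x s) (u s)) (f t s (x s) (u' s))
          (f t s (x' s) (u' s))
        have t2 := norm_sub_le_norm_sub_add_norm_sub (g t s (x s) (u s)) (g t s (x s) (u' s))
          (g t s (x' s) (u' s))
        simp only [Gf, Gg]
        nlinarith [mul_le_mul_of_nonneg_left t1 hτ]
      simp only [Pi.add_apply]
      have e1 : x t - x' t = (x₀ t - x₀' t) +
          (((∫ s in Ioc 0 t, (t - s) ^ (α - 1) • f t s (x s) (u s)) -
            ∫ s in Ioc 0 t, (t - s) ^ (α - 1) • f t s (x' s) (u' s)) +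
          ((∫ s in Ioc 0 t, g t s (x s) (u s)) - ∫ s in Ioc 0 t, g t s (x' s) (u' s))) := by
        rw [h1, h2]; abel
      rw [e1, add_assoc]
      refine (enorm_add_le _ _).trans (add_le_add_right ((enorm_add_le _ _).trans ?_) _)
      exact (add_le_add i1 i2).trans i3)
  have hmink := (ENNReal.lintegral_Lp_add_le hx0ae (hAf.aemeasurable.add hAg.aemeasurable) hp1).trans
    (add_le_add_right (ENNReal.lintegral_Lp_add_le (μ := μ) hAf.aemeasurable hAg.aemeasurable hp1) _)
  have hfinal := hmain.trans (mul_le_mul_right hmink C)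
  rw [← conv_real hp1 hdx, ← conv_real hp1 hdx0, ← hcf, ← hcg] at hfinal
  have n0 : ∀ r : ℝ, 0 ≤ r → 0 ≤ r ^ (1/p) := fun r hr => Real.rpow_nonneg hr _
  have q0 : 0 ≤ (∫ t in Ioc 0 T, ‖x₀ t - x₀' t‖ ^ p) ^ (1/p) :=
    n0 _ (integral_nonneg fun t => by positivity)
  have q1 : 0 ≤ (∫ t in Ioc 0 T, (∫ s in Ioc 0 t, Gf t s) ^ p) ^ (1/p) :=
    n0 _ (integral_nonneg fun t => Real.rpow_nonneg
      (setIntegral_nonneg measurableSet_Ioc fun s hs => hGf0 t s hs) _)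
  have q2 : 0 ≤ (∫ t in Ioc 0 T, (∫ s in Ioc 0 t, Gg t s) ^ p) ^ (1/p) :=
    n0 _ (integral_nonneg fun t => Real.rpow_nonneg
      (setIntegral_nonneg measurableSet_Ioc fun s hs => hGg0 t s hs) _)
  rw [← ENNReal.ofReal_add q1 q2, ← ENNReal.ofReal_add q0 (add_nonneg q1 q2),
    ← ENNReal.ofReal_toReal hC, ← ENNReal.ofReal_mul ENNReal.toReal_nonneg,
    ENNReal.ofReal_le_ofReal_iff (mul_nonneg ENNReal.toReal_nonneg
      (add_nonneg q0 (add_nonneg q1 q2)))] at hfinal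
  rw [mul_add, mul_add, ← add_assoc] at hfinal
  exact hfinal

/-- Lemma B.1, stability estimate: under Assumption B, there is a constant
`C ≥ 0` such that the `Lᵖ`-solutions of the generalized Volterra equation corresponding to two
sets of data satisfy the stated stability estimate. -/
theorem generalized_volterra_stability
    {n d : ℕ} (T : ℝ) (hT : 0 < T) (α : ℝ) (hα : α ∈ Set.Ioo (0:ℝ) 1)
    (p : ℝ) (hp1 : 1 ≤ p)
    (U : Set (Euc d)) (u₀ : Euc d) (hu₀U : u₀ ∈ U)
    (f g : ℝ → ℝ → Euc n → Euc d → Euc n)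
    (hf_meas : Measurable fun q : ℝ × ℝ × Euc n × Euc d => f q.1 q.2.1 q.2.2.1 q.2.2.2)
    (hg_meas : Measurable fun q : ℝ × ℝ × Euc n × Euc d => g q.1 q.2.1 q.2.2.1 q.2.2.2)
    -- Assumption B
    (K₀ K : ℝ → ℝ) (hK₀_nonneg : ∀ s, 0 ≤ K₀ s) (hK_nonneg : ∀ s, 0 ≤ K s)
    (hK₀_meas : Measurable K₀) (hK_meas : Measurable K)
    (r₀ : ℝ) (hr₀ : max (p / (1 + α * p)) 1 < r₀)
    (hK₀_L : IntegrableOn (fun s => K₀ s ^ r₀) (Set.Ioc 0 T))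
    (hK_L : (1 < p ∧ ∃ r₁ : ℝ, max (1 / α) (p / (p - 1)) < r₁ ∧
              IntegrableOn (fun s => K s ^ r₁) (Set.Ioc 0 T)) ∨
            (p = 1 ∧ ∃ M : ℝ, ∀ s ∈ Set.Ioc (0:ℝ) T, K s ≤ M))
    (hA_lip : ∀ t s : ℝ, 0 ≤ s → s ≤ t → t ≤ T →
      ∀ (x x' : Euc n) (u u' : Euc d), u ∈ U → u' ∈ U →
        ‖f t s x u - f t s x' u'‖ + ‖g t s x u - g t s x' u'‖ ≤ K s * (‖x - x'‖ + ‖u - u'‖))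
    (hA_zero : ∀ t s : ℝ, 0 ≤ s → s ≤ t → t ≤ T → ∀ u : Euc d, u ∈ U →
      ‖f t s 0 u‖ + ‖g t s 0 u‖ ≤ K₀ s) :
    ∃ C : ℝ, 0 ≤ C ∧
      ∀ x₀ x₀' : ℝ → Euc n,
        AEStronglyMeasurable x₀ (volume.restrict (Set.Ioc 0 T)) →
        IntegrableOn (fun t => ‖x₀ t‖ ^ p) (Set.Ioc 0 T) →
        AEStronglyMeasurable x₀' (volume.restrict (Set.Ioc 0 T)) →
        IntegrableOn (fun t => ‖x₀' t‖ ^ p) (Set.Ioc 0 T) →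
        ∀ u u' : ℝ → Euc d, Admissible T p U u₀ u → Admissible T p U u₀ u' →
        ∀ x x' : ℝ → Euc n,
          IsLpSolution T α p f g x₀ u x → IsLpSolution T α p f g x₀' u' x' →
          (∫ t in Set.Ioc 0 T, ‖x t - x' t‖ ^ p) ^ (1 / p)
            ≤ C * (∫ t in Set.Ioc 0 T, ‖x₀ t - x₀' t‖ ^ p) ^ (1 / p)
              + C * (∫ t in Set.Ioc 0 T,
                  (∫ s in Set.Ioc 0 t,
                    ((t - s) ^ (α - 1)) * ‖f t s (x s) (u s) - f t s (x s) (u' s)‖) ^ p) ^ (1 / p)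
              + C * (∫ t in Set.Ioc 0 T,
                  (∫ s in Set.Ioc 0 t,
                    ‖g t s (x s) (u s) - g t s (x s) (u' s)‖) ^ p) ^ (1 / p) := by
  obtain ⟨C, hC, H⟩ := stability_meas T hT α hα p hp1 U u₀ hu₀U f g hf_meas hg_meas K₀ K hK₀_nonneg
    hK_nonneg hK₀_meas hK_meas r₀ hr₀ hK₀_L hK_L hA_lip hA_zero
  refine ⟨C, hC, ?_⟩
  intro x₀ x₀' hx₀m hx₀i hx₀m' hx₀i' u u' hu hu' x x' hx hx'
  -- replace a solution by a measurable version
  have rep : ∀ (z₀ : ℝ → Euc n) (v : ℝ → Euc d) (z : ℝ → Euc n), IsLpSolution T α p f g z₀ v z →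
      ∃ y : ℝ → Euc n, Measurable y ∧ z =ᵐ[volume.restrict (Ioc 0 T)] y ∧
        IsLpSolution T α p f g z₀ v y := by
    intro z₀ v z hz
    obtain ⟨hzm, hzi, hze⟩ := hz
    refine ⟨hzm.mk z, hzm.measurable_mk, hzm.ae_eq_mk, hzm.measurable_mk.aestronglyMeasurable,
      ?_, ?_⟩
    · refine hzi.congr ?_
      filter_upwards [hzm.ae_eq_mk] with t ht
      rw [ht]
    · filter_upwards [hzm.ae_eq_mk, hze, ae_restrict_mem measurableSet_Ioc] with t h1 h2 ht
      have h3 : ∀ᵐ s ∂(volume.restrict (Ioc 0 t)), z s = hzm.mk z s :=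
        ae_restrict_of_ae_restrict_of_subset (Ioc_subset_Ioc_right ht.2) hzm.ae_eq_mk
      rw [← h1, h2]
      congr 1
      · congr 1
        refine integral_congr_ae ?_
        filter_upwards [h3] with s hs
        rw [hs]
      · refine integral_congr_ae ?_
        filter_upwards [h3] with s hs
        rw [hs]
  obtain ⟨y, hym, hxy, hy⟩ := rep x₀ u x hx
  obtain ⟨y', hym', hxy', hy'⟩ := rep x₀' u' x' hx'
  have h := H x₀ x₀' hx₀m hx₀i hx₀m' hx₀i' u u' hu hu' y y' hym hym' hy hy'
  have h3 : ∀ t ∈ Ioc 0 T, ∀ᵐ s ∂(volume.restrict (Ioc 0 t)), x s = y s := fun t ht =>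
    ae_restrict_of_ae_restrict_of_subset (Ioc_subset_Ioc_right ht.2) hxy
  have e1 : ∫ t in Set.Ioc 0 T, ‖x t - x' t‖ ^ p = ∫ t in Set.Ioc 0 T, ‖y t - y' t‖ ^ p := by
    refine integral_congr_ae ?_
    filter_upwards [hxy, hxy'] with t h1 h2
    rw [h1, h2]
  have e2 : (∫ t in Set.Ioc 0 T, (∫ s in Set.Ioc 0 t,
        ((t - s) ^ (α - 1)) * ‖f t s (x s) (u s) - f t s (x s) (u' s)‖) ^ p) =
      ∫ t in Set.Ioc 0 T, (∫ s in Set.Ioc 0 t,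
        ((t - s) ^ (α - 1)) * ‖f t s (y s) (u s) - f t s (y s) (u' s)‖) ^ p := by
    refine setIntegral_congr_fun measurableSet_Ioc fun t ht => ?_
    congr 1
    refine integral_congr_ae ?_
    filter_upwards [h3 t ht] with s hs
    rw [hs]
  have e3 : (∫ t in Set.Ioc 0 T, (∫ s in Set.Ioc 0 t,
        ‖g t s (x s) (u s) - g t s (x s) (u' s)‖) ^ p) =
      ∫ t in Set.Ioc 0 T, (∫ s in Set.Ioc 0 t,
        ‖g t s (y s) (u s) - g t s (y s) (u' s)‖) ^ p := by
    refine setIntegral_congr_fun measurableSet_Ioc fun t ht => ?_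
    congr 1
    refine integral_congr_ae ?_
    filter_upwards [h3 t ht] with s hs
    rw [hs]
  rw [e1, e2, e3]
  exact h
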